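/- Let γ : ℝ × (-∞,0] → ℝ² be an ancient closed embedded smooth curve shortening flow, i.e. γ is 1-periodic in the space variable u and γ(·,t) is injective on [0,1) for each t. Then the flow has finite total curvature (sup over t ≤ 0 of ∫_{[0,1)} |κ(u,t)| |∂_u γ(u,t)| du is finite) if and only if it has finite entropy (sup over t ≤ 0, x₀ ∈ ℝ², λ > 0 of (4πλ)^{-1/2} ∫_{[0,1)} exp(-|γ(u,t)-x₀|²/(4λ)) |∂_u γ(u,t)| du is finite). -/

import Mathlib

open Real MeasureTheory Set Filter
open scoped RealInnerProductSpace ENNReal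

noncomputable section

/-- The Euclidean plane. -/
abbrev R2 := EuclideanSpace ℝ (Fin 2)

/-- The point of `ℝ²` with coordinates `(x, y)`. -/
def toR2 (x y : ℝ) : R2 := (WithLp.equiv 2 (Fin 2 → ℝ)).symm ![x, y]

/-- Counterclockwise rotation of the plane by `π/2`. -/
def Jrot (v : R2) : R2 := toR2 (-(v 1)) (v 0)

/-- Arclength derivative `∂ₛ := |∂ᵤγ|⁻¹ ∂ᵤ` along the time-`t` curve of the flow `γ`,
applied to a function `f` of `(u, t)`. -/
def aderiv (γ : ℝ → ℝ → R2) {F : Type} [NormedAddCommGroup F] [NormedSpace ℝ F]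
    (f : ℝ → ℝ → F) (u t : ℝ) : F :=
  ‖deriv (fun v => γ v t) u‖⁻¹ • deriv (fun v => f v t) u

/-- The unit tangent `T = ∂ᵤγ / |∂ᵤγ|`. -/
def unitT (γ : ℝ → ℝ → R2) (u t : ℝ) : R2 := aderiv γ γ u t

/-- The unit normal `n = J T`. -/
def unitN (γ : ℝ → ℝ → R2) (u t : ℝ) : R2 := Jrot (unitT γ u t)

/-- The signed curvature `κ = ⟨∂ₛT, n⟩`. -/
def curv (γ : ℝ → ℝ → R2) (u t : ℝ) : ℝ := ⟪aderiv γ (unitT γ) u t, unitN γ u t⟫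

/-- `γ : ℝ × I → ℝ²` is a smooth curve shortening flow in fixed-parametrization form:
smooth, regular (`∂ᵤγ ≠ 0`), and `∂ₜγ = ∂ₛ(∂ₛγ)` (time derivative taken within `I`). -/
structure IsCSF (γ : ℝ → ℝ → R2) (I : Set ℝ) : Prop where
  smooth : ContDiffOn ℝ (⊤ : ℕ∞) (fun p : ℝ × ℝ => γ p.1 p.2) (univ ×ˢ I)
  regular : ∀ (u : ℝ), ∀ t ∈ I, deriv (fun v => γ v t) u ≠ 0
  flow : ∀ (u : ℝ), ∀ t ∈ I, derivWithin (fun s => γ u s) I t = aderiv γ (aderiv γ γ) u t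

/-- The Gaussian weighted length `F_{x₀,l}` of the time-`t` curve (as an extended real). -/
def gaussLenE (γ : ℝ → ℝ → R2) (x₀ : R2) (l t : ℝ) : ℝ≥0∞ :=
  (ENNReal.ofReal (Real.sqrt (4 * π * l)))⁻¹ *
    ∫⁻ u : ℝ, ENNReal.ofReal
      (Real.exp (-‖γ u t - x₀‖ ^ 2 / (4 * l)) * ‖deriv (fun v => γ v t) u‖)

/-- The total curvature of the time-`t` curve (as an extended real). -/
def totalCurvE (γ : ℝ → ℝ → R2) (t : ℝ) : ℝ≥0∞ :=
  ∫⁻ u : ℝ, ENNReal.ofReal (|curv γ u t| * ‖deriv (fun v => γ v t) u‖)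

/-- The entropy of the flow: the supremum of the Gaussian weighted lengths over all
times `t ∈ I`, centers `x₀ ∈ ℝ²` and scales `l > 0`. -/
def entropyE (γ : ℝ → ℝ → R2) (I : Set ℝ) : ℝ≥0∞ :=
  ⨆ t ∈ I, ⨆ x₀ : R2, ⨆ l ∈ Ioi (0:ℝ), gaussLenE γ x₀ l t

/-- The Gaussian weighted length of the time-`t` curve of a closed flow
(`1`-periodic parametrization, integral over one period `[0,1)`). -/
def gaussLenClosedE (γ : ℝ → ℝ → R2) (x₀ : R2) (l t : ℝ) : ℝ≥0∞ :=
  (ENNReal.ofReal (Real.sqrt (4 * π * l)))⁻¹ *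
    ∫⁻ u in Ico (0:ℝ) 1, ENNReal.ofReal
      (Real.exp (-‖γ u t - x₀‖ ^ 2 / (4 * l)) * ‖deriv (fun v => γ v t) u‖)

/-- The total curvature of the time-`t` curve of a closed flow (over one period `[0,1)`). -/
def totalCurvClosedE (γ : ℝ → ℝ → R2) (t : ℝ) : ℝ≥0∞ :=
  ∫⁻ u in Ico (0:ℝ) 1, ENNReal.ofReal (|curv γ u t| * ‖deriv (fun v => γ v t) u‖)

/-- The entropy of a closed flow on time interval `I`. -/
def entropyClosedE (γ : ℝ → ℝ → R2) (I : Set ℝ) : ℝ≥0∞ :=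
  ⨆ t ∈ I, ⨆ x₀ : R2, ⨆ l ∈ Ioi (0:ℝ), gaussLenClosedE γ x₀ l t

/-! ### Calculus on the closed half plane `t ≤ 0` -/

/-- The space-time domain, with points `(t, u)`. -/
def Om : Set (ℝ × ℝ) := Iic (0:ℝ) ×ˢ (univ : Set ℝ)

/-- Smooth functions on the space-time domain. -/
def Sm (F : ℝ × ℝ → ℝ) : Prop := ContDiffOn ℝ (⊤ : ℕ∞) F Om

/-- Directional derivative. -/
def pd (e : ℝ × ℝ) (F : ℝ × ℝ → ℝ) (p : ℝ × ℝ) : ℝ := fderivWithin ℝ F Om p e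

/-- Periodic functions in the space variable. -/
def Per (F : ℝ × ℝ → ℝ) : Prop := ∀ t ≤ 0, ∀ u, F (t, u + 1) = F (t, u)

lemma Om_convex : Convex ℝ Om := (convex_Iic 0).prod convex_univ

lemma Om_interior : interior Om = Iio (0:ℝ) ×ˢ (univ : Set ℝ) := by
  simp [Om, interior_prod_eq]

lemma Om_unique : UniqueDiffOn ℝ Om := by
  apply uniqueDiffOn_convex Om_convex
  rw [Om_interior]
  exact ⟨(-1, 0), by simp⟩

lemma mem_Om {t u : ℝ} : (t, u) ∈ Om ↔ t ≤ 0 := by simp [Om]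

lemma Om_closure {p : ℝ × ℝ} (hp : p ∈ Om) : p ∈ closure (interior Om) := by
  rw [Om_interior, closure_prod_eq]
  simpa [Om] using hp

lemma Sm.diff {F : ℝ × ℝ → ℝ} (h : Sm F) {p : ℝ × ℝ} (hp : p ∈ Om) :
    DifferentiableWithinAt ℝ F Om p :=
  (ContDiffOn.differentiableOn h (by simp)) p hp

lemma Sm.pd {F : ℝ × ℝ → ℝ} (h : Sm F) (e : ℝ × ℝ) : Sm (pd e F) := by
  have := ContDiffOn.fderivWithin (m := (⊤ : ℕ∞)) h Om_unique (by simp)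
  exact this.clm_apply contDiffOn_const

lemma Sm.mul {F G : ℝ × ℝ → ℝ} (h : Sm F) (h' : Sm G) : Sm (fun p => F p * G p) :=
  ContDiffOn.mul h h'
lemma Sm.add {F G : ℝ × ℝ → ℝ} (h : Sm F) (h' : Sm G) : Sm (fun p => F p + G p) :=
  ContDiffOn.add h h'
lemma Sm.sub {F G : ℝ × ℝ → ℝ} (h : Sm F) (h' : Sm G) : Sm (fun p => F p - G p) :=
  ContDiffOn.sub h h'
lemma Sm.const (c : ℝ) : Sm (fun _ => c) := contDiffOn_const
lemma Sm.fst : Sm (fun p => p.1) := contDiffOn_fst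
lemma Sm.div {F G : ℝ × ℝ → ℝ} (h : Sm F) (h' : Sm G) (h0 : ∀ p ∈ Om, G p ≠ 0) :
    Sm (fun p => F p / G p) := ContDiffOn.div h h' h0
lemma Sm.sqrt {F : ℝ × ℝ → ℝ} (h : Sm F) (h0 : ∀ p ∈ Om, F p ≠ 0) :
    Sm (fun p => √(F p)) := ContDiffOn.sqrt h h0
lemma Sm.exp {F : ℝ × ℝ → ℝ} (h : Sm F) : Sm (fun p => Real.exp (F p)) := ContDiffOn.exp h

lemma pd_congr {F G : ℝ × ℝ → ℝ} (h : ∀ p ∈ Om, F p = G p) (e : ℝ × ℝ) {p : ℝ × ℝ}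
    (hp : p ∈ Om) : pd e F p = pd e G p := by
  unfold pd
  rw [fderivWithin_congr h (h p hp)]

lemma pd_add {F G : ℝ × ℝ → ℝ} (h : Sm F) (h' : Sm G) (e : ℝ × ℝ) {p : ℝ × ℝ} (hp : p ∈ Om) :
    pd e (fun p => F p + G p) p = pd e F p + pd e G p := by
  unfold pd
  rw [fderivWithin_fun_add (Om_unique p hp) (h.diff hp) (h'.diff hp)]; simp

lemma pd_sub {F G : ℝ × ℝ → ℝ} (h : Sm F) (h' : Sm G) (e : ℝ × ℝ) {p : ℝ × ℝ} (hp : p ∈ Om) :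
    pd e (fun p => F p - G p) p = pd e F p - pd e G p := by
  unfold pd
  rw [fderivWithin_fun_sub (Om_unique p hp) (h.diff hp) (h'.diff hp)]; simp

lemma pd_mul {F G : ℝ × ℝ → ℝ} (h : Sm F) (h' : Sm G) (e : ℝ × ℝ) {p : ℝ × ℝ} (hp : p ∈ Om) :
    pd e (fun p => F p * G p) p = pd e F p * G p + F p * pd e G p := by
  unfold pd
  rw [fderivWithin_fun_mul (Om_unique p hp) (h.diff hp) (h'.diff hp)]
  simp; ring

lemma pd_const (c : ℝ) (e : ℝ × ℝ) (p : ℝ × ℝ) : pd e (fun _ => c) p = 0 := by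
  simp [pd]

lemma pd_fst (e : ℝ × ℝ) {p : ℝ × ℝ} (hp : p ∈ Om) : pd e (fun p => p.1) p = e.1 := by
  unfold pd
  rw [fderivWithin_fst (Om_unique p hp)]; simp

lemma pd_exp {F : ℝ × ℝ → ℝ} (h : Sm F) (e : ℝ × ℝ) {p : ℝ × ℝ} (hp : p ∈ Om) :
    pd e (fun p => Real.exp (F p)) p = Real.exp (F p) * pd e F p := by
  unfold pd
  rw [fderivWithin_exp (h.diff hp) (Om_unique p hp)]; simp

lemma pd_comm {F : ℝ × ℝ → ℝ} (h : Sm F) (e e' : ℝ × ℝ) {p : ℝ × ℝ} (hp : p ∈ Om) :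
    pd e (pd e' F) p = pd e' (pd e F) p := by
  have hs : IsSymmSndFDerivWithinAt ℝ F Om p :=
    ContDiffWithinAt.isSymmSndFDerivWithinAt (n := (⊤ : ℕ∞)) (h p hp)
      (by rw [minSmoothness_of_isRCLikeNormedField]; exact WithTop.coe_le_coe.2 (le_top : (2 : ℕ∞) ≤ ⊤)) Om_unique (Om_closure hp) hp
  have hd : DifferentiableWithinAt ℝ (fderivWithin ℝ F Om) Om p :=
    (ContDiffOn.fderivWithin (m := (⊤ : ℕ∞)) h Om_unique (by simp)).differentiableOn
      (by simp) p hp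
  have key : ∀ e e' : ℝ × ℝ, pd e (pd e' F) p
      = fderivWithin ℝ (fderivWithin ℝ F Om) Om p e e' := by
    intro e e'
    change fderivWithin ℝ (fun q => fderivWithin ℝ F Om q e') Om p e = _
    rw [fderivWithin_clm_apply (Om_unique p hp) hd (differentiableWithinAt_const _)]
    simp
  rw [key, key]
  exact hs.eq e e'

lemma Sm.hasDerivAt_u {F : ℝ × ℝ → ℝ} (h : Sm F) {t : ℝ} (ht : t ≤ 0) (u : ℝ) :
    HasDerivAt (fun x => F (t, x)) (_root_.pd (0, 1) F (t, u)) u := by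
  have h1 := (h.diff (mem_Om.2 ht : (t, u) ∈ Om)).hasFDerivWithinAt
  have h2 : HasDerivWithinAt (fun x : ℝ => (t, x)) ((0:ℝ), (1:ℝ)) univ u :=
    ((hasDerivAt_const u t).prodMk (hasDerivAt_id u)).hasDerivWithinAt
  have := h1.comp_hasDerivWithinAt u h2 (fun x _ => mem_Om.2 ht)
  exact hasDerivWithinAt_univ.1 this

lemma Sm.hasDerivWithinAt_t {F : ℝ × ℝ → ℝ} (h : Sm F) {t : ℝ} (ht : t ≤ 0) (u : ℝ) :
    HasDerivWithinAt (fun x => F (x, u)) (_root_.pd (1, 0) F (t, u)) (Iic 0) t := by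
  have h1 := (h.diff (mem_Om.2 ht : (t, u) ∈ Om)).hasFDerivWithinAt
  have h2 : HasDerivWithinAt (fun x : ℝ => (x, u)) ((1:ℝ), (0:ℝ)) (Iic 0) t :=
    ((hasDerivAt_id t).prodMk (hasDerivAt_const t u)).hasDerivWithinAt
  exact h1.comp_hasDerivWithinAt t h2 (fun x hx => mem_Om.2 hx)

lemma Per.pd {F : ℝ × ℝ → ℝ} (h : Per F) (hs : Sm F) : Per (pd (0, 1) F) := by
  intro t ht u
  have h1 := (hs.hasDerivAt_u ht (u + 1)).comp_add_const u 1
  have h2 := hs.hasDerivAt_u ht u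
  have h3 : (fun x => F (t, x + 1)) = fun x => F (t, x) := by
    funext x; exact h t ht x
  rw [h3] at h1
  exact h1.unique h2

lemma Sm.cont_u {F : ℝ × ℝ → ℝ} (h : Sm F) {t : ℝ} (ht : t ≤ 0) :
    Continuous (fun x => F (t, x)) :=
  continuous_iff_continuousAt.2 fun u => (h.hasDerivAt_u ht u).continuousAt

/-! ### Geometric data of a closed curve shortening flow -/

/-- Position `(X, Y)`, speed `v`, tangent `(a, b)` and curvature `k` of a closed flow. -/
structure CF (X Y v a b k : ℝ × ℝ → ℝ) : Prop where
  sX : Sm X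
  sY : Sm Y
  sv : Sm v
  sa : Sm a
  sb : Sm b
  sk : Sm k
  pX : Per X
  pY : Per Y
  pv : Per v
  pa : Per a
  pb : Per b
  pk : Per k
  vpos : ∀ p ∈ Om, 0 < v p
  ab : ∀ p ∈ Om, a p * a p + b p * b p = 1
  Xu : ∀ p ∈ Om, pd (0, 1) X p = v p * a p
  Yu : ∀ p ∈ Om, pd (0, 1) Y p = v p * b p
  au : ∀ p ∈ Om, pd (0, 1) a p = - (v p * k p * b p)
  bu : ∀ p ∈ Om, pd (0, 1) b p = v p * k p * a p
  Xt : ∀ p ∈ Om, pd (1, 0) X p = - (k p * b p)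
  Yt : ∀ p ∈ Om, pd (1, 0) Y p = k p * a p

lemma hasDerivWithinAt_toR2 {f g : ℝ → ℝ} {f' g' x : ℝ} {s : Set ℝ}
    (hf : HasDerivWithinAt f f' s x) (hg : HasDerivWithinAt g g' s x) :
    HasDerivWithinAt (fun y => toR2 (f y) (g y)) (toR2 f' g') s x := by
  rw [hasDerivWithinAt_iff_hasFDerivWithinAt, hasFDerivWithinAt_euclidean]
  intro i
  fin_cases i
  · convert! hf.hasFDerivWithinAt using 1
  · convert! hg.hasFDerivWithinAt using 1

lemma hasDerivAt_toR2 {f g : ℝ → ℝ} {f' g' x : ℝ}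
    (hf : HasDerivAt f f' x) (hg : HasDerivAt g g' x) :
    HasDerivAt (fun y => toR2 (f y) (g y)) (toR2 f' g') x := by
  rw [← hasDerivWithinAt_univ] at *
  exact hasDerivWithinAt_toR2 hf hg

lemma toR2_eta (z : R2) : z = toR2 (z 0) (z 1) := by
  ext i; fin_cases i <;> simp [toR2]

lemma norm_toR2 (x y : ℝ) : ‖toR2 x y‖ = √(x * x + y * y) := by
  simp [toR2, EuclideanSpace.norm_eq, Fin.sum_univ_two, pow_two]

lemma smul_toR2 (c x y : ℝ) : c • toR2 x y = toR2 (c * x) (c * y) := by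
  ext i; fin_cases i <;> simp [toR2]

lemma toR2_inj {x y x' y' : ℝ} (h : toR2 x y = toR2 x' y') : x = x' ∧ y = y' := by
  constructor
  · simpa [toR2] using congrArg (fun z : R2 => z 0) h
  · simpa [toR2] using congrArg (fun z : R2 => z 1) h

lemma inner_toR2 (x y x' y' : ℝ) : ⟪toR2 x y, toR2 x' y'⟫ = x * x' + y * y' := by
  simp [toR2, PiLp.inner_apply, Fin.sum_univ_two]; ring

theorem exists_CF (γ : ℝ → ℝ → R2) (hcsf : IsCSF γ (Iic 0))
    (hper : ∀ (u t : ℝ), γ (u + 1) t = γ u t) :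
    ∃ X Y v a b k : ℝ × ℝ → ℝ, CF X Y v a b k ∧
      (∀ t u, γ u t = toR2 (X (t, u)) (Y (t, u))) ∧
      (∀ t ≤ 0, ∀ u, ‖deriv (fun v => γ v t) u‖ = v (t, u)) ∧
      (∀ t ≤ 0, ∀ u, curv γ u t = k (t, u)) := by
  set X : ℝ × ℝ → ℝ := fun p => γ p.2 p.1 0 with hX
  set Y : ℝ × ℝ → ℝ := fun p => γ p.2 p.1 1 with hY
  have hγ : ∀ t u, γ u t = toR2 (X (t, u)) (Y (t, u)) := fun t u => toR2_eta _
  have hsm : ContDiffOn ℝ (⊤ : ℕ∞) (fun p : ℝ × ℝ => γ p.2 p.1) Om := by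
    have h1 : ContDiffOn ℝ (⊤ : ℕ∞) (fun p : ℝ × ℝ => (p.2, p.1)) Om :=
      contDiffOn_snd.prodMk contDiffOn_fst
    exact hcsf.smooth.comp h1 (fun p hp => ⟨mem_univ _, hp.1⟩)
  have hc := contDiffOn_euclidean.1 hsm
  have sX : Sm X := hc 0
  have sY : Sm Y := hc 1
  have pX : Per X := fun t _ u => by simp [hX, hper]
  have pY : Per Y := fun t _ u => by simp [hY, hper]
  have hdγ : ∀ t ≤ 0, ∀ u, deriv (fun v => γ v t) u
      = toR2 (pd (0, 1) X (t, u)) (pd (0, 1) Y (t, u)) := by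
    intro t ht u
    have := hasDerivAt_toR2 (sX.hasDerivAt_u ht u) (sY.hasDerivAt_u ht u)
    simp only [← hγ] at this
    exact this.deriv
  set w : ℝ × ℝ → ℝ := fun p => pd (0, 1) X p * pd (0, 1) X p + pd (0, 1) Y p * pd (0, 1) Y p
    with hw
  have sw : Sm w := ((sX.pd _).mul (sX.pd _)).add ((sY.pd _).mul (sY.pd _))
  have pw : Per w := fun t ht u => by
    simp only [hw, pX.pd sX t ht u, pY.pd sY t ht u]
  have hv : ∀ t ≤ 0, ∀ u, ‖deriv (fun v => γ v t) u‖ = √(w (t, u)) := by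
    intro t ht u
    rw [hdγ t ht u, norm_toR2]
  have vpos : ∀ p ∈ Om, 0 < √(w p) := by
    rintro ⟨t, u⟩ hp
    rw [← hv t (mem_Om.1 hp) u]
    exact norm_pos_iff.2 (hcsf.regular u t (mem_Om.1 hp))
  have wne : ∀ p ∈ Om, w p ≠ 0 := fun p hp => (Real.sqrt_pos.1 (vpos p hp)).ne'
  set v : ℝ × ℝ → ℝ := fun p => √(w p) with hvdef
  have sv : Sm v := sw.sqrt wne
  have vne : ∀ p ∈ Om, v p ≠ 0 := fun p hp => (vpos p hp).ne'
  have vv : ∀ p ∈ Om, v p * v p = w p := fun p hp =>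
    Real.mul_self_sqrt (Real.sqrt_pos.1 (vpos p hp)).le
  have pv : Per v := fun t ht u => by simp only [hvdef, pw t ht u]
  set a : ℝ × ℝ → ℝ := fun p => pd (0, 1) X p / v p with ha
  set b : ℝ × ℝ → ℝ := fun p => pd (0, 1) Y p / v p with hb
  have sa : Sm a := (sX.pd _).div sv vne
  have sb : Sm b := (sY.pd _).div sv vne
  have pa : Per a := fun t ht u => by simp only [ha, pX.pd sX t ht u, pv t ht u]
  have pb : Per b := fun t ht u => by simp only [hb, pY.pd sY t ht u, pv t ht u]
  have Xu : ∀ p ∈ Om, pd (0, 1) X p = v p * a p := fun p hp => by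
    simp only [ha]; field_simp [vne p hp]
  have Yu : ∀ p ∈ Om, pd (0, 1) Y p = v p * b p := fun p hp => by
    simp only [hb]; field_simp [vne p hp]
  have ab : ∀ p ∈ Om, a p * a p + b p * b p = 1 := by
    intro p hp
    have h1 := vv p hp
    simp only [hw, Xu p hp, Yu p hp] at h1
    have h2 : v p * v p ≠ 0 := mul_ne_zero (vne p hp) (vne p hp)
    apply mul_left_cancel₀ h2
    linarith
  set k : ℝ × ℝ → ℝ := fun p => (a p * pd (0, 1) b p - b p * pd (0, 1) a p) / v p with hk
  have sk : Sm k := ((sa.mul (sb.pd _)).sub (sb.mul (sa.pd _))).div sv vne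
  have pk : Per k := fun t ht u => by
    simp only [hk, pa.pd sa t ht u, pb.pd sb t ht u, pa t ht u, pb t ht u, pv t ht u]
  have vk : ∀ p ∈ Om, v p * k p = a p * pd (0, 1) b p - b p * pd (0, 1) a p := fun p hp => by
    simp only [hk]; field_simp [vne p hp]
  have orth : ∀ p ∈ Om, a p * pd (0, 1) a p + b p * pd (0, 1) b p = 0 := by
    intro p hp
    have h1 := pd_congr ab (0, 1) hp
    rw [pd_add (sa.mul sa) (sb.mul sb) _ hp, pd_mul sa sa _ hp, pd_mul sb sb _ hp, pd_const] at h1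
    linarith
  have au : ∀ p ∈ Om, pd (0, 1) a p = - (v p * k p * b p) := by
    intro p hp
    rw [vk p hp]
    linear_combination (- pd (0,1) a p) * ab p hp + a p * orth p hp
  have bu : ∀ p ∈ Om, pd (0, 1) b p = v p * k p * a p := by
    intro p hp
    rw [vk p hp]
    linear_combination (- pd (0,1) b p) * ab p hp + b p * orth p hp
  have hT : ∀ t ≤ 0, ∀ u, aderiv γ γ u t = toR2 (a (t, u)) (b (t, u)) := by
    intro t ht u
    simp only [aderiv]
    rw [hv t ht u, hdγ t ht u, smul_toR2]
    simp only [ha, hb, hvdef, div_eq_inv_mul]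
  have hTT : ∀ t ≤ 0, ∀ u, aderiv γ (aderiv γ γ) u t
      = toR2 (- (k (t, u) * b (t, u))) (k (t, u) * a (t, u)) := by
    intro t ht u
    have hp : (t, u) ∈ Om := mem_Om.2 ht
    have h1 := hasDerivAt_toR2 (sa.hasDerivAt_u ht u) (sb.hasDerivAt_u ht u)
    have h2 : (fun y => aderiv γ γ y t) = fun y => toR2 (a (t, y)) (b (t, y)) := by
      funext y; exact hT t ht y
    rw [aderiv, h2, h1.deriv, hv t ht u, smul_toR2, au _ hp, bu _ hp]
    have := vne _ hp
    congr 1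
    · change (v (t, u))⁻¹ * _ = _
      field_simp
    · change (v (t, u))⁻¹ * _ = _
      field_simp
  have hflow : ∀ p ∈ Om, pd (1, 0) X p = - (k p * b p) ∧ pd (1, 0) Y p = k p * a p := by
    rintro ⟨t, u⟩ hp
    have ht := mem_Om.1 hp
    have h1 := hasDerivWithinAt_toR2 (sX.hasDerivWithinAt_t ht u) (sY.hasDerivWithinAt_t ht u)
    simp only [← hγ] at h1
    have h2 := h1.derivWithin (uniqueDiffOn_Iic 0 t ht)
    rw [hcsf.flow u t ht, hTT t ht u] at h2
    have := toR2_inj h2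
    exact ⟨this.1.symm, this.2.symm⟩
  refine ⟨X, Y, v, a, b, k, ⟨sX, sY, sv, sa, sb, sk, pX, pY, pv, pa, pb, pk, vpos, ab, Xu, Yu,
    au, bu, fun p hp => (hflow p hp).1, fun p hp => (hflow p hp).2⟩, hγ, hv, ?_⟩
  intro t ht u
  have hp : (t, u) ∈ Om := mem_Om.2 ht
  have h1 : aderiv γ (unitT γ) u t
      = toR2 (- (k (t, u) * b (t, u))) (k (t, u) * a (t, u)) := hTT t ht u
  have h2 : unitT γ u t = toR2 (a (t, u)) (b (t, u)) := hT t ht u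
  have h3 : unitN γ u t = toR2 (- b (t, u)) (a (t, u)) := by
    rw [unitN, h2]; simp [Jrot, toR2]
  rw [curv, h1, h3, inner_toR2]
  linear_combination k (t, u) * ab _ hp

/-! ### From finite entropy to finite total curvature -/

section Evolution

variable {X Y v a b k : ℝ × ℝ → ℝ}

lemma CF.Xtu (h : CF X Y v a b k) {p : ℝ × ℝ} (hp : p ∈ Om) :
    pd (1, 0) v p * a p + v p * pd (1, 0) a p
      = - (pd (0, 1) k p * b p) - k p * (v p * k p * a p) := by
  have h1 := pd_comm h.sX (1, 0) (0, 1) hp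
  rw [pd_congr h.Xu _ hp, pd_mul h.sv h.sa _ hp] at h1
  have h2 : ∀ p ∈ Om, pd (1, 0) X p = 0 - k p * b p := fun p hp => by rw [h.Xt p hp]; ring
  rw [pd_congr h2 _ hp, pd_sub (Sm.const 0) (h.sk.mul h.sb) _ hp, pd_mul h.sk h.sb _ hp,
    pd_const, h.bu p hp] at h1
  linarith

lemma CF.Ytu (h : CF X Y v a b k) {p : ℝ × ℝ} (hp : p ∈ Om) :
    pd (1, 0) v p * b p + v p * pd (1, 0) b p
      = pd (0, 1) k p * a p - k p * (v p * k p * b p) := by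
  have h1 := pd_comm h.sY (1, 0) (0, 1) hp
  rw [pd_congr h.Yu _ hp, pd_mul h.sv h.sb _ hp, pd_congr h.Yt _ hp, pd_mul h.sk h.sa _ hp,
    h.au p hp] at h1
  linarith

lemma CF.orth_t (h : CF X Y v a b k) {p : ℝ × ℝ} (hp : p ∈ Om) :
    a p * pd (1, 0) a p + b p * pd (1, 0) b p = 0 := by
  have h1 := pd_congr h.ab (1, 0) hp
  rw [pd_add (h.sa.mul h.sa) (h.sb.mul h.sb) _ hp, pd_mul h.sa h.sa _ hp,
    pd_mul h.sb h.sb _ hp, pd_const] at h1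
  linarith

lemma CF.vt (h : CF X Y v a b k) {p : ℝ × ℝ} (hp : p ∈ Om) :
    pd (1, 0) v p = - (k p * k p * v p) := by
  linear_combination a p * h.Xtu hp + b p * h.Ytu hp - v p * h.orth_t hp
    - (pd (1, 0) v p + k p * k p * v p) * h.ab p hp

/-- The arclength derivative of the curvature. -/
def ks (v k : ℝ × ℝ → ℝ) (p : ℝ × ℝ) : ℝ := pd (0, 1) k p / v p

lemma CF.vne (h : CF X Y v a b k) : ∀ p ∈ Om, v p ≠ 0 := fun p hp => (h.vpos p hp).ne'

lemma CF.sks (h : CF X Y v a b k) : Sm (ks v k) := (h.sk.pd _).div h.sv h.vne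

lemma CF.pks (h : CF X Y v a b k) : Per (ks v k) := fun t ht u => by
  simp only [ks, h.pk.pd h.sk t ht u, h.pv t ht u]

lemma CF.ku (h : CF X Y v a b k) {p : ℝ × ℝ} (hp : p ∈ Om) :
    pd (0, 1) k p = v p * ks v k p := by
  have := h.vne p hp
  simp only [ks]; field_simp

lemma CF.a_t (h : CF X Y v a b k) : ∀ p ∈ Om, pd (1, 0) a p = 0 - ks v k p * b p := by
  intro p hp
  have h1 := h.Xtu hp
  rw [h.vt hp, h.ku hp] at h1
  apply mul_left_cancel₀ (h.vne p hp)
  linarith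

lemma CF.b_t (h : CF X Y v a b k) : ∀ p ∈ Om, pd (1, 0) b p = ks v k p * a p := by
  intro p hp
  have h1 := h.Ytu hp
  rw [h.vt hp, h.ku hp] at h1
  apply mul_left_cancel₀ (h.vne p hp)
  linarith

lemma CF.vkt (h : CF X Y v a b k) {p : ℝ × ℝ} (hp : p ∈ Om) :
    pd (1, 0) (fun p => v p * k p) p = pd (0, 1) (ks v k) p := by
  have sq : Sm (fun p => v p * k p) := h.sv.mul h.sk
  have h1 := pd_comm h.sa (1, 0) (0, 1) hp
  have h2 := pd_comm h.sb (1, 0) (0, 1) hp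
  have hau : ∀ p ∈ Om, pd (0, 1) a p = 0 - v p * k p * b p := fun p hp => by
    rw [h.au p hp]; ring
  rw [pd_congr hau _ hp, pd_sub (Sm.const 0) (sq.mul h.sb) _ hp, pd_mul sq h.sb _ hp, pd_const,
    pd_congr h.a_t _ hp, pd_sub (Sm.const 0) (h.sks.mul h.sb) _ hp, pd_mul h.sks h.sb _ hp,
    pd_const, h.b_t p hp, h.bu p hp] at h1
  rw [pd_congr h.bu _ hp, pd_mul sq h.sa _ hp,
    pd_congr h.b_t _ hp, pd_mul h.sks h.sa _ hp, h.a_t p hp, h.au p hp] at h2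
  linear_combination (- b p) * h1 + a p * h2
    - (pd (1, 0) (fun p => v p * k p) p - pd (0, 1) (ks v k) p) * h.ab p hp

lemma CF.kt (h : CF X Y v a b k) {p : ℝ × ℝ} (hp : p ∈ Om) :
    v p * pd (1, 0) k p = pd (0, 1) (ks v k) p + v p * k p ^ 3 := by
  have h1 := h.vkt hp
  rw [pd_mul h.sv h.sk _ hp, h.vt hp] at h1
  linear_combination h1

/-- Gaussian weight. -/
def ph (X Y : ℝ × ℝ → ℝ) (m : ℝ) (p : ℝ × ℝ) : ℝ :=
  Real.exp (-(m ^ 2 / 4) * (X p * X p + Y p * Y p))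

/-- Tangential part of the position. -/
def ta (X Y a b : ℝ × ℝ → ℝ) (p : ℝ × ℝ) : ℝ := a p * X p + b p * Y p

/-- Normal part of the position. -/
def nu (X Y a b : ℝ × ℝ → ℝ) (p : ℝ × ℝ) : ℝ := a p * Y p - b p * X p

/-- Regularised absolute curvature. -/
def ff (k : ℝ × ℝ → ℝ) (m : ℝ) (p : ℝ × ℝ) : ℝ := √(k p * k p + m * m)

lemma CF.sph (h : CF X Y v a b k) (m : ℝ) : Sm (ph X Y m) :=
  ((Sm.const _).mul ((h.sX.mul h.sX).add (h.sY.mul h.sY))).exp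

lemma CF.pd_ph (h : CF X Y v a b k) (m : ℝ) (e : ℝ × ℝ) {p : ℝ × ℝ} (hp : p ∈ Om) :
    pd e (ph X Y m) p = -(m ^ 2 / 2) * ph X Y m p * (X p * pd e X p + Y p * pd e Y p) := by
  have hs := (h.sX.mul h.sX).add (h.sY.mul h.sY)
  have := pd_exp ((Sm.const (-(m ^ 2 / 4))).mul hs) e hp
  rw [pd_mul (Sm.const _) hs _ hp, pd_const, pd_add (h.sX.mul h.sX) (h.sY.mul h.sY) _ hp,
    pd_mul h.sX h.sX _ hp, pd_mul h.sY h.sY _ hp] at this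
  change pd e (fun p => Real.exp (-(m ^ 2 / 4) * (X p * X p + Y p * Y p))) p = _
  rw [this, ph]
  ring

lemma CF.ph_u (h : CF X Y v a b k) (m : ℝ) {p : ℝ × ℝ} (hp : p ∈ Om) :
    pd (0, 1) (ph X Y m) p = -(m ^ 2 / 2) * ph X Y m p * (v p * ta X Y a b p) := by
  rw [h.pd_ph m _ hp, h.Xu p hp, h.Yu p hp, ta]; ring

lemma CF.ph_t (h : CF X Y v a b k) (m : ℝ) {p : ℝ × ℝ} (hp : p ∈ Om) :
    pd (1, 0) (ph X Y m) p = -(m ^ 2 / 2) * ph X Y m p * (k p * nu X Y a b p) := by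
  rw [h.pd_ph m _ hp, h.Xt p hp, h.Yt p hp, nu]; ring

lemma CF.sta (h : CF X Y v a b k) : Sm (ta X Y a b) := (h.sa.mul h.sX).add (h.sb.mul h.sY)

lemma CF.ta_u (h : CF X Y v a b k) {p : ℝ × ℝ} (hp : p ∈ Om) :
    pd (0, 1) (ta X Y a b) p = v p * (1 + k p * nu X Y a b p) := by
  change pd (0, 1) (fun p => a p * X p + b p * Y p) p = _
  rw [pd_add (h.sa.mul h.sX) (h.sb.mul h.sY) _ hp, pd_mul h.sa h.sX _ hp, pd_mul h.sb h.sY _ hp,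
    h.au p hp, h.bu p hp, h.Xu p hp, h.Yu p hp, nu]
  linear_combination v p * h.ab p hp

lemma ff_pos {m : ℝ} (hm : 0 < m) (p : ℝ × ℝ) : 0 < ff k m p :=
  Real.sqrt_pos.2 (by nlinarith [mul_self_nonneg (k p)])

lemma ff_sq (m : ℝ) (p : ℝ × ℝ) : ff k m p * ff k m p = k p * k p + m * m :=
  Real.mul_self_sqrt (by nlinarith [mul_self_nonneg (k p), mul_self_nonneg m])

lemma CF.sff (h : CF X Y v a b k) {m : ℝ} (hm : 0 < m) : Sm (ff k m) :=
  ((h.sk.mul h.sk).add (Sm.const (m * m))).sqrt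
    (fun p _ => by nlinarith [mul_self_nonneg (k p)])

lemma CF.pd_ff (h : CF X Y v a b k) {m : ℝ} (hm : 0 < m) (e : ℝ × ℝ) {p : ℝ × ℝ} (hp : p ∈ Om) :
    ff k m p * pd e (ff k m) p = k p * pd e k p := by
  have h1 := pd_congr (fun p (_ : p ∈ Om) => ff_sq (k := k) m p) e hp
  rw [pd_mul (h.sff hm) (h.sff hm) _ hp, pd_add (h.sk.mul h.sk) (Sm.const _) _ hp,
    pd_mul h.sk h.sk _ hp, pd_const] at h1
  linarith

/-- Weighted length density. -/
def H1 (X Y v : ℝ × ℝ → ℝ) (m : ℝ) (p : ℝ × ℝ) : ℝ := ph X Y m p * v p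
/-- Flux for `H1`. -/
def Q1 (X Y a b : ℝ × ℝ → ℝ) (m : ℝ) (p : ℝ × ℝ) : ℝ :=
  -(m ^ 2 / 2) * (ph X Y m p * ta X Y a b p)
/-- Weighted curvature density. -/
def H2 (X Y v k : ℝ × ℝ → ℝ) (m : ℝ) (p : ℝ × ℝ) : ℝ :=
  ph X Y m p * ph X Y m p * (v p * ff k m p)
/-- Flux for `H2`. -/
def Q2 (X Y v a b k : ℝ × ℝ → ℝ) (m : ℝ) (p : ℝ × ℝ) : ℝ :=
  ph X Y m p * ph X Y m p * (k p * ks v k p / ff k m p + m ^ 2 * (ta X Y a b p * ff k m p))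

lemma CF.sH1 (h : CF X Y v a b k) (m : ℝ) : Sm (H1 X Y v m) := (h.sph m).mul h.sv
lemma CF.sQ1 (h : CF X Y v a b k) (m : ℝ) : Sm (Q1 X Y a b m) :=
  (Sm.const _).mul ((h.sph m).mul h.sta)
lemma CF.sH2 (h : CF X Y v a b k) {m : ℝ} (hm : 0 < m) : Sm (H2 X Y v k m) :=
  ((h.sph m).mul (h.sph m)).mul (h.sv.mul (h.sff hm))
lemma CF.sQ2a (h : CF X Y v a b k) {m : ℝ} (hm : 0 < m) :
    Sm (fun p => k p * ks v k p / ff k m p) :=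
  (h.sk.mul h.sks).div (h.sff hm) (fun p _ => (ff_pos hm p).ne')
lemma CF.sQ2 (h : CF X Y v a b k) {m : ℝ} (hm : 0 < m) : Sm (Q2 X Y v a b k m) :=
  ((h.sph m).mul (h.sph m)).mul ((h.sQ2a hm).add ((Sm.const _).mul (h.sta.mul (h.sff hm))))

lemma CF.evol1 (h : CF X Y v a b k) (m : ℝ) {p : ℝ × ℝ} (hp : p ∈ Om) :
    pd (1, 0) (H1 X Y v m) p - pd (0, 1) (Q1 X Y a b m) p
      = ph X Y m p * v p * (- (k p) ^ 2 + m ^ 2 / 2 - m ^ 4 * (ta X Y a b p) ^ 2 / 4) := by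
  change pd (1, 0) (fun p => ph X Y m p * v p) p
    - pd (0, 1) (fun p => -(m ^ 2 / 2) * (ph X Y m p * ta X Y a b p)) p = _
  rw [pd_mul (h.sph m) h.sv _ hp, pd_mul (Sm.const _) ((h.sph m).mul h.sta) _ hp, pd_const,
    pd_mul (h.sph m) h.sta _ hp, h.ph_t m hp, h.ph_u m hp, h.ta_u hp, h.vt hp]
  ring

lemma CF.pd_Q2a (h : CF X Y v a b k) {m : ℝ} (hm : 0 < m) {p : ℝ × ℝ} (hp : p ∈ Om) :
    ff k m p ^ 3 * pd (0, 1) (fun p => k p * ks v k p / ff k m p) p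
      = m ^ 2 * v p * ks v k p ^ 2 + ff k m p ^ 2 * (k p * pd (0, 1) (ks v k) p) := by
  have hf := (ff_pos (k := k) hm p).ne'
  have h1 : ∀ p ∈ Om, (k p * ks v k p / ff k m p) * ff k m p = k p * ks v k p := fun p _ => by
    have hf := (ff_pos (k := k) hm p).ne'
    field_simp
  have h2 := pd_congr h1 (0, 1) hp
  rw [pd_mul (h.sQ2a hm) (h.sff hm) _ hp, pd_mul h.sk h.sks _ hp, h.ku hp] at h2
  have h3 := h.pd_ff hm (0, 1) hp
  rw [h.ku hp] at h3
  have h4 := ff_sq (k := k) m p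
  set D := pd (0, 1) (fun p => k p * ks v k p / ff k m p) p
  set E := pd (0, 1) (ff k m) p
  have h5 := h1 p hp
  set z := k p * ks v k p / ff k m p
  set f := ff k m p
  -- D f + z E = v ks^2 + k ks_u, f E = k v ks, z f = k ks
  linear_combination f ^ 2 * h2 - f * z * h3 - k p * v p * ks v k p * h5
    + v p * ks v k p ^ 2 * h4

lemma CF.evol2 (h : CF X Y v a b k) {m : ℝ} (hm : 0 < m) {p : ℝ × ℝ} (hp : p ∈ Om) :
    pd (1, 0) (H2 X Y v k m) p - pd (0, 1) (Q2 X Y v a b k m) p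
      ≤ ph X Y m p ^ 2 * v p * ff k m p
        * (2 * m ^ 2 * (|k p| * |nu X Y a b p|) + m ^ 4 * ta X Y a b p ^ 2) := by
  have hfp := ff_pos (k := k) hm p
  have hkt := h.kt hp
  have hvp := h.vpos p hp
  have e1 : pd (1, 0) (H2 X Y v k m) p
      = -(m ^ 2) * ph X Y m p ^ 2 * (k p * nu X Y a b p) * (v p * ff k m p)
        + ph X Y m p ^ 2 * (- (k p * k p * v p) * ff k m p + v p * pd (1, 0) (ff k m) p) := by
    change pd (1, 0) (fun p => ph X Y m p * ph X Y m p * (v p * ff k m p)) p = _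
    rw [pd_mul ((h.sph m).mul (h.sph m)) (h.sv.mul (h.sff hm)) _ hp,
      pd_mul (h.sph m) (h.sph m) _ hp, pd_mul h.sv (h.sff hm) _ hp, h.ph_t m hp, h.vt hp]
    ring
  have e2 : pd (0, 1) (Q2 X Y v a b k m) p
      = -(m ^ 2) * ph X Y m p ^ 2 * (v p * ta X Y a b p)
          * (k p * ks v k p / ff k m p + m ^ 2 * (ta X Y a b p * ff k m p))
        + ph X Y m p ^ 2 * (pd (0, 1) (fun p => k p * ks v k p / ff k m p) p
          + m ^ 2 * (v p * (1 + k p * nu X Y a b p) * ff k m p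
            + ta X Y a b p * pd (0, 1) (ff k m) p)) := by
    change pd (0, 1) (fun p => ph X Y m p * ph X Y m p *
      (k p * ks v k p / ff k m p + m ^ 2 * (ta X Y a b p * ff k m p))) p = _
    rw [pd_mul ((h.sph m).mul (h.sph m))
        ((h.sQ2a hm).add ((Sm.const _).mul (h.sta.mul (h.sff hm)))) _ hp,
      pd_mul (h.sph m) (h.sph m) _ hp,
      pd_add (h.sQ2a hm) ((Sm.const _).mul (h.sta.mul (h.sff hm))) _ hp,
      pd_mul (Sm.const _) (h.sta.mul (h.sff hm)) _ hp, pd_const,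
      pd_mul h.sta (h.sff hm) _ hp, h.ph_u m hp, h.ta_u hp]
    ring
  have h3 := h.pd_ff hm (0, 1) hp
  rw [h.ku hp] at h3
  have h3t := h.pd_ff hm (1, 0) hp
  have h4 := ff_sq (k := k) m p
  have h5 := h.pd_Q2a hm hp
  rw [e1, e2]
  set D := pd (0, 1) (fun p => k p * ks v k p / ff k m p) p
  set E := pd (0, 1) (ff k m) p
  set Et := pd (1, 0) (ff k m) p
  set W := pd (0, 1) (ks v k) p
  set f := ff k m p
  set z := ks v k p
  set τ := ta X Y a b p
  set n := nu X Y a b p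
  set φ := ph X Y m p
  set V := v p
  set K := k p
  have hE : E = K * (V * z) / f := by rw [← h3]; field_simp
  have hvEt : V * Et = K * (W + V * K ^ 3) / f := by
    rw [← hkt]; field_simp; linear_combination h3t
  have hD : D = m ^ 2 * V * z ^ 2 / f ^ 3 + K * W / f := by
    field_simp; linear_combination h5
  have hkk : K ^ 4 / f - K ^ 2 * f = - (K ^ 2 * m ^ 2 / f) := by
    field_simp; linear_combination (- K ^ 2) * h4
  have hmain : -(m ^ 2) * φ ^ 2 * (K * n) * (V * f)
        + φ ^ 2 * (- (K * K * V) * f + V * Et)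
      - (-(m ^ 2) * φ ^ 2 * (V * τ) * (K * z / f + m ^ 2 * (τ * f))
        + φ ^ 2 * (D + m ^ 2 * (V * (1 + K * n) * f + τ * E)))
      = φ ^ 2 * V * f * (-2 * m ^ 2 * (K * n) + m ^ 4 * τ ^ 2)
        - φ ^ 2 * V * (K ^ 2 * m ^ 2 / f) - φ ^ 2 * (m ^ 2 * V * z ^ 2 / f ^ 3)
        - φ ^ 2 * (m ^ 2 * V * f) := by
    rw [hvEt, hE, hD]
    have : K * (W + V * K ^ 3) / f = K * W / f + V * (K ^ 4 / f) := by ring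
    rw [this]
    linear_combination φ ^ 2 * V * hkk
  rw [hmain]
  have g1 : 0 ≤ φ ^ 2 * V * (K ^ 2 * m ^ 2 / f) := by positivity
  have g2 : 0 ≤ φ ^ 2 * (m ^ 2 * V * z ^ 2 / f ^ 3) := by positivity
  have g3 : 0 ≤ φ ^ 2 * (m ^ 2 * V * f) := by positivity
  have g4 : -2 * m ^ 2 * (K * n) ≤ 2 * m ^ 2 * (|K| * |n|) := by
    rw [← abs_mul]
    nlinarith [neg_abs_le (K * n), sq_nonneg m]
  have g5 : φ ^ 2 * V * f * (-2 * m ^ 2 * (K * n) + m ^ 4 * τ ^ 2)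
      ≤ φ ^ 2 * V * f * (2 * m ^ 2 * (|K| * |n|) + m ^ 4 * τ ^ 2) := by
    gcongr
  linarith

lemma ph_pos (m : ℝ) (p : ℝ × ℝ) : 0 < ph X Y m p := Real.exp_pos _

lemma ph_le_one (m : ℝ) (p : ℝ × ℝ) : ph X Y m p ≤ 1 := by
  apply Real.exp_le_one_iff.2
  nlinarith [mul_nonneg (sq_nonneg m) (add_nonneg (mul_self_nonneg (X p)) (mul_self_nonneg (Y p)))]

lemma ph_bound (m : ℝ) (p : ℝ × ℝ) :
    ph X Y m p * (1 + m ^ 2 / 4 * (X p * X p + Y p * Y p)) ≤ 1 := by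
  have h1 := Real.add_one_le_exp (m ^ 2 / 4 * (X p * X p + Y p * Y p))
  have h2 : ph X Y m p * Real.exp (m ^ 2 / 4 * (X p * X p + Y p * Y p)) = 1 := by
    rw [ph, ← Real.exp_add]; simp
  rw [← h2]
  have := (ph_pos (X := X) (Y := Y) m p).le
  gcongr
  linarith

lemma CF.split (h : CF X Y v a b k) {p : ℝ × ℝ} (hp : p ∈ Om) :
    X p * X p + Y p * Y p = ta X Y a b p ^ 2 + nu X Y a b p ^ 2 := by
  simp only [ta, nu]
  linear_combination (-(X p * X p + Y p * Y p)) * h.ab p hp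

lemma CF.bd_nu (h : CF X Y v a b k) (m : ℝ) {p : ℝ × ℝ} (hp : p ∈ Om) :
    ph X Y m p * (m * |nu X Y a b p|) ≤ 1 := by
  refine le_trans ?_ (ph_bound (X := X) (Y := Y) m p)
  rw [h.split hp]
  have := (ph_pos (X := X) (Y := Y) m p).le
  gcongr
  have h1 := sq_abs (nu X Y a b p)
  nlinarith [sq_nonneg (m * |nu X Y a b p| / 2 - 1), mul_nonneg (sq_nonneg m)
    (sq_nonneg (ta X Y a b p))]

lemma CF.bd_ta (h : CF X Y v a b k) (m : ℝ) {p : ℝ × ℝ} (hp : p ∈ Om) :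
    ph X Y m p * (m ^ 2 * ta X Y a b p ^ 2) ≤ 4 := by
  have h1 := ph_bound (X := X) (Y := Y) m p
  rw [h.split hp] at h1
  have h2 := (ph_pos (X := X) (Y := Y) m p).le
  have h3 : ph X Y m p * (m ^ 2 * ta X Y a b p ^ 2)
      ≤ ph X Y m p * (4 * (1 + m ^ 2 / 4 * (ta X Y a b p ^ 2 + nu X Y a b p ^ 2))) := by
    apply mul_le_mul_of_nonneg_left _ h2
    nlinarith [mul_nonneg (sq_nonneg m) (sq_nonneg (nu X Y a b p))]
  linarith

lemma CF.evol2' (h : CF X Y v a b k) {m : ℝ} (hm : 0 < m) {p : ℝ × ℝ} (hp : p ∈ Om) :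
    pd (1, 0) (H2 X Y v k m) p - pd (0, 1) (Q2 X Y v a b k m) p
      ≤ 6 * m * (ph X Y m p * v p * ff k m p ^ 2) := by
  refine (h.evol2 hm hp).trans ?_
  have h1 := h.bd_nu m hp
  have h2 := h.bd_ta m hp
  have hf := ff_pos (k := k) hm p
  have hφ := ph_pos (X := X) (Y := Y) m p
  have hv := h.vpos p hp
  have h4 := ff_sq (k := k) m p
  have hk : |k p| ≤ ff k m p := Real.abs_le_sqrt (by nlinarith)
  have hmf : m ≤ ff k m p := Real.le_sqrt_of_sq_le (by nlinarith [mul_self_nonneg (k p)])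
  calc _ = ph X Y m p * v p * ff k m p * (2 * m * |k p| * (ph X Y m p * (m * |nu X Y a b p|))
            + m ^ 2 * (ph X Y m p * (m ^ 2 * ta X Y a b p ^ 2))) := by ring
    _ ≤ ph X Y m p * v p * ff k m p * (2 * m * ff k m p * 1 + m * ff k m p * 4) := by
        have h6 : m ^ 2 ≤ m * ff k m p := by nlinarith
        gcongr
    _ = _ := by ring

/-- The combined density. -/
def HH (X Y v k : ℝ × ℝ → ℝ) (m t₁ : ℝ) (p : ℝ × ℝ) : ℝ :=
  m ^ 2 * (p.1 - t₁) * H2 X Y v k m p + 7 * m * H1 X Y v m p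
/-- The combined flux. -/
def QQ (X Y v a b k : ℝ × ℝ → ℝ) (m t₁ : ℝ) (p : ℝ × ℝ) : ℝ :=
  m ^ 2 * (p.1 - t₁) * Q2 X Y v a b k m p + 7 * m * Q1 X Y a b m p

lemma sm_h (m t₁ : ℝ) : Sm (fun p => m ^ 2 * (p.1 - t₁)) :=
  (Sm.const _).mul (Sm.fst.sub (Sm.const _))

lemma CF.sHH (h : CF X Y v a b k) {m : ℝ} (hm : 0 < m) (t₁ : ℝ) : Sm (HH X Y v k m t₁) :=
  ((sm_h m t₁).mul (h.sH2 hm)).add ((Sm.const _).mul (h.sH1 m))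
lemma CF.sQQ (h : CF X Y v a b k) {m : ℝ} (hm : 0 < m) (t₁ : ℝ) : Sm (QQ X Y v a b k m t₁) :=
  ((sm_h m t₁).mul (h.sQ2 hm)).add ((Sm.const _).mul (h.sQ1 m))

lemma pd_lin {F G : ℝ × ℝ → ℝ} (hF : Sm F) (hG : Sm G) (m t₁ c : ℝ) (e : ℝ × ℝ) {p : ℝ × ℝ}
    (hp : p ∈ Om) : pd e (fun p => m ^ 2 * (p.1 - t₁) * F p + c * G p) p
      = m ^ 2 * e.1 * F p + m ^ 2 * (p.1 - t₁) * pd e F p + c * pd e G p := by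
  rw [pd_add ((sm_h m t₁).mul hF) ((Sm.const _).mul hG) _ hp, pd_mul (sm_h m t₁) hF _ hp,
    pd_mul (Sm.const _) hG _ hp, pd_const, pd_mul (Sm.const _) (Sm.fst.sub (Sm.const _)) _ hp,
    pd_sub Sm.fst (Sm.const _) _ hp, pd_const, pd_const, pd_fst _ hp]
  ring

lemma CF.evol (h : CF X Y v a b k) {m : ℝ} (hm : 0 < m) (t₁ : ℝ) {p : ℝ × ℝ} (hp : p ∈ Om)
    (ht1 : 0 ≤ m ^ 2 * (p.1 - t₁)) (ht2 : m ^ 2 * (p.1 - t₁) ≤ 1) :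
    pd (1, 0) (HH X Y v k m t₁) p - pd (0, 1) (QQ X Y v a b k m t₁) p
      ≤ 21 / 2 * m ^ 3 * H1 X Y v m p := by
  have e1 := pd_lin (h.sH2 hm) (h.sH1 m) m t₁ (7 * m) (1, 0) hp
  have e2 := pd_lin (h.sQ2 hm) (h.sQ1 m) m t₁ (7 * m) (0, 1) hp
  change pd (1, 0) (fun p => m ^ 2 * (p.1 - t₁) * H2 X Y v k m p + 7 * m * H1 X Y v m p) p -
    pd (0, 1) (fun p => m ^ 2 * (p.1 - t₁) * Q2 X Y v a b k m p + 7 * m * Q1 X Y a b m p) p ≤ _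
  rw [e1, e2]
  have h1 := h.evol1 m hp
  have h2 := h.evol2' hm hp
  have hf := ff_pos (k := k) hm p
  have hφ := ph_pos (X := X) (Y := Y) m p
  have hφ1 := ph_le_one (X := X) (Y := Y) m p
  have hv := h.vpos p hp
  have h4 := ff_sq (k := k) m p
  have hmf : m ≤ ff k m p := Real.le_sqrt_of_sq_le (by nlinarith [mul_self_nonneg (k p)])
  have h5 : m ^ 2 * H2 X Y v k m p ≤ m * (ph X Y m p * v p * ff k m p ^ 2) := by
    calc m ^ 2 * H2 X Y v k m p
        = m * (ph X Y m p * v p * ff k m p) * (m * ph X Y m p) := by rw [H2]; ring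
      _ ≤ m * (ph X Y m p * v p * ff k m p) * (ff k m p * 1) := by gcongr
      _ = _ := by ring
  have h6 : m ^ 2 * (p.1 - t₁) *
      (pd (1, 0) (H2 X Y v k m) p - pd (0, 1) (Q2 X Y v a b k m) p)
      ≤ 6 * m * (ph X Y m p * v p * ff k m p ^ 2) := by
    calc _ ≤ m ^ 2 * (p.1 - t₁) * (6 * m * (ph X Y m p * v p * ff k m p ^ 2)) := by gcongr
      _ ≤ 1 * (6 * m * (ph X Y m p * v p * ff k m p ^ 2)) := by gcongr
      _ = _ := by ring
  have h7 : 7 * m * (pd (1, 0) (H1 X Y v m) p - pd (0, 1) (Q1 X Y a b m) p)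
      ≤ 7 * m * (ph X Y m p * v p * (-(k p) ^ 2 + m ^ 2 / 2)) := by
    rw [h1]
    gcongr
    have : 0 ≤ m ^ 4 * ta X Y a b p ^ 2 := by positivity
    linarith
  have h8 : ff k m p ^ 2 = k p ^ 2 + m ^ 2 := by linarith
  rw [h8] at h5 h6
  rw [H1] at *
  simp only [mul_one, mul_zero, zero_mul, zero_add]
  linarith

lemma CF.pHH (h : CF X Y v a b k) (m t₁ : ℝ) : Per (QQ X Y v a b k m t₁) := by
  intro t ht u
  simp only [QQ, Q1, Q2, ph, ta, ff, h.pX t ht u, h.pY t ht u, h.pa t ht u, h.pb t ht u,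
    h.pk t ht u, h.pks t ht u]

lemma Sm.hasFDerivAt {F : ℝ × ℝ → ℝ} (h : Sm F) {p : ℝ × ℝ} (hp : p.1 < 0) :
    HasFDerivAt F (fderivWithin ℝ F Om p) p := by
  have hi : p ∈ interior Om := by rw [Om_interior]; exact ⟨hp, mem_univ _⟩
  exact (h.diff (interior_subset hi)).hasFDerivWithinAt.hasFDerivAt (mem_interior_iff_mem_nhds.1 hi)

lemma CF.integral_ineq (h : CF X Y v a b k) {m : ℝ} (hm : 0 < m) {t₀ C : ℝ} (ht₀ : t₀ ≤ 0)
    (hC : ∀ t ≤ 0, m * ∫ u in (0:ℝ)..1, H1 X Y v m (t, u) ≤ C) :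
    ∫ u in (0:ℝ)..1, H2 X Y v k m (t₀, u) ≤ 35 / 2 * C := by
  set t₁ : ℝ := t₀ - (m ^ 2)⁻¹ with ht₁
  have hinv : 0 < (m ^ 2)⁻¹ := by positivity
  have hlt : t₁ ≤ t₀ := by linarith
  have hsub : uIcc t₁ t₀ ×ˢ uIcc (0:ℝ) 1 ⊆ Om := by
    rintro ⟨t, u⟩ ⟨h1, _⟩
    rw [uIcc_of_le hlt] at h1
    exact mem_Om.2 (h1.2.trans ht₀)
  have hcomp : IsCompact (uIcc t₁ t₀ ×ˢ uIcc (0:ℝ) 1) := isCompact_uIcc.prod isCompact_uIcc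
  have sH := h.sHH hm t₁
  have sQ := h.sQQ hm t₁
  have sH' : Sm (fun p => pd (1, 0) (HH X Y v k m t₁) p - pd (0, 1) (QQ X Y v a b k m t₁) p) :=
    (sH.pd _).sub (sQ.pd _)
  have hintegr : ∀ {F : ℝ × ℝ → ℝ}, Sm F → IntegrableOn F (uIcc t₁ t₀ ×ˢ uIcc (0:ℝ) 1) :=
    fun hF => (ContinuousOn.mono (ContDiffOn.continuousOn hF) hsub).integrableOn_compact hcomp
  have hdiv := integral2_divergence_prod_of_hasFDerivAt_off_countable
    (HH X Y v k m t₁) (fun p => - QQ X Y v a b k m t₁ p)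
    (fun p => fderivWithin ℝ (HH X Y v k m t₁) Om p)
    (fun p => - fderivWithin ℝ (QQ X Y v a b k m t₁) Om p) t₁ 0 t₀ 1 ∅ countable_empty
    (ContinuousOn.mono (ContDiffOn.continuousOn sH) hsub)
    (ContinuousOn.mono (ContDiffOn.continuousOn sQ) hsub).neg
    (by
      rintro p ⟨⟨h1, _⟩, _⟩
      rw [max_eq_right hlt] at h1
      exact sH.hasFDerivAt (h1.2.trans_le ht₀))
    (by
      rintro p ⟨⟨h1, _⟩, _⟩
      rw [max_eq_right hlt] at h1
      exact (sQ.hasFDerivAt (h1.2.trans_le ht₀)).neg)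
    (by simpa [pd, sub_eq_add_neg] using hintegr sH')
  have hper : ∫ x in t₁..t₀, - QQ X Y v a b k m t₁ (x, 1)
      = ∫ x in t₁..t₀, - QQ X Y v a b k m t₁ (x, 0) := by
    apply intervalIntegral.integral_congr
    intro t ht
    rw [uIcc_of_le hlt] at ht
    have := h.pHH m t₁ t (ht.2.trans ht₀) 0
    rw [zero_add] at this
    simp only [this]
  rw [hper, sub_self, zero_add] at hdiv
  -- the double integral
  have hle : (∫ t in t₁..t₀, ∫ u in (0:ℝ)..1, (pd (1, 0) (HH X Y v k m t₁) (t, u)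
        - pd (0, 1) (QQ X Y v a b k m t₁) (t, u))) ≤ ∫ t in t₁..t₀, 21 / 2 * m ^ 2 * C := by
    apply intervalIntegral.integral_mono_on hlt
    · rw [intervalIntegrable_iff]
      have h1 := hintegr sH'
      have h2 : IntegrableOn (fun p => pd (1, 0) (HH X Y v k m t₁) p
          - pd (0, 1) (QQ X Y v a b k m t₁) p) (uIoc t₁ t₀ ×ˢ uIoc (0:ℝ) 1) :=
        h1.mono_set (prod_mono uIoc_subset_uIcc uIoc_subset_uIcc)
      rw [IntegrableOn, Measure.volume_eq_prod, ← Measure.prod_restrict] at h2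
      have h3 := h2.integral_prod_left
      simp only [intervalIntegral.integral_of_le (zero_le_one (α := ℝ))]
      rw [uIoc_of_le (zero_le_one (α := ℝ))] at h3
      exact h3
    · exact intervalIntegrable_const
    · intro t ht
      have ht0 : t ≤ 0 := ht.2.trans ht₀
      have h1 : ∫ u in (0:ℝ)..1, (pd (1, 0) (HH X Y v k m t₁) (t, u)
          - pd (0, 1) (QQ X Y v a b k m t₁) (t, u))
          ≤ ∫ u in (0:ℝ)..1, 21 / 2 * m ^ 3 * H1 X Y v m (t, u) := by
        apply intervalIntegral.integral_mono_on zero_le_one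
        · exact (sH'.cont_u ht0).intervalIntegrable _ _
        · exact (((h.sH1 m).cont_u ht0).const_mul _).intervalIntegrable _ _
        · intro u _
          apply h.evol hm t₁ (mem_Om.2 ht0)
          · have : 0 ≤ t - t₁ := by linarith [ht.1]
            exact mul_nonneg (sq_nonneg _) this
          · have h5 : t - t₁ ≤ (m ^ 2)⁻¹ := by rw [ht₁]; linarith [ht.2]
            calc m ^ 2 * (t - t₁) ≤ m ^ 2 * (m ^ 2)⁻¹ := by gcongr
              _ = 1 := by field_simp
      rw [intervalIntegral.integral_const_mul] at h1
      have h2 := hC t ht0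
      calc _ ≤ _ := h1
        _ = 21 / 2 * m ^ 2 * (m * ∫ u in (0:ℝ)..1, H1 X Y v m (t, u)) := by ring
        _ ≤ _ := by gcongr
  have hconst : ∫ t in t₁..t₀, 21 / 2 * m ^ 2 * C = 21 / 2 * C := by
    rw [intervalIntegral.integral_const, smul_eq_mul, ht₁]
    field_simp; ring
  rw [hconst] at hle
  have hdiv' : (∫ t in t₁..t₀, ∫ u in (0:ℝ)..1, (pd (1, 0) (HH X Y v k m t₁) (t, u)
        - pd (0, 1) (QQ X Y v a b k m t₁) (t, u)))
      = (∫ u in (0:ℝ)..1, HH X Y v k m t₁ (t₀, u)) - ∫ u in (0:ℝ)..1, HH X Y v k m t₁ (t₁, u) := by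
    rw [← hdiv]
    simp [pd, sub_eq_add_neg]
  rw [hdiv'] at hle
  have h1 : ∫ u in (0:ℝ)..1, HH X Y v k m t₁ (t₁, u)
      = 7 * (m * ∫ u in (0:ℝ)..1, H1 X Y v m (t₁, u)) := by
    simp only [HH, sub_self, mul_zero, zero_mul, zero_add]
    rw [intervalIntegral.integral_const_mul]; ring
  have h2 : ∫ u in (0:ℝ)..1, H2 X Y v k m (t₀, u)
      ≤ ∫ u in (0:ℝ)..1, HH X Y v k m t₁ (t₀, u) := by
    apply intervalIntegral.integral_mono_on zero_le_one
    · exact ((h.sH2 hm).cont_u ht₀).intervalIntegrable _ _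
    · exact (sH.cont_u ht₀).intervalIntegrable _ _
    · intro u _
      have h3 : m ^ 2 * (t₀ - t₁) = 1 := by rw [ht₁]; field_simp; ring
      have h4 : 0 ≤ H1 X Y v m (t₀, u) :=
        mul_nonneg (ph_pos _ _).le (h.vpos _ (mem_Om.2 ht₀)).le
      simp only [HH, h3, one_mul]
      have : 0 ≤ 7 * m * H1 X Y v m (t₀, u) := by positivity
      linarith
  have h3 := hC t₁ (hlt.trans ht₀)
  linarith

/-- Uniform bound of the total curvature by the Gaussian densities. -/
theorem CF.totalCurv_le (h : CF X Y v a b k) {C : ℝ}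
    (hC : ∀ m > 0, ∀ t ≤ 0, m * ∫ u in (0:ℝ)..1, H1 X Y v m (t, u) ≤ C) {t : ℝ} (ht : t ≤ 0) :
    ∫ u in (0:ℝ)..1, |k (t, u)| * v (t, u) ≤ 35 / 2 * C := by
  have hcR : Continuous fun u => X (t, u) * X (t, u) + Y (t, u) * Y (t, u) :=
    (((h.sX.mul h.sX).add (h.sY.mul h.sY)).cont_u ht)
  obtain ⟨M, hM⟩ := (isCompact_Icc (a := (0:ℝ)) (b := 1)).bddAbove_image hcR.continuousOn
  have hck : Continuous fun u => |k (t, u)| * v (t, u) :=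
    (h.sk.cont_u ht).abs.mul (h.sv.cont_u ht)
  set K := ∫ u in (0:ℝ)..1, |k (t, u)| * v (t, u) with hK
  have key : ∀ m > 0, Real.exp (-(m ^ 2 / 2) * M) * K ≤ 35 / 2 * C := by
    intro m hm
    refine le_trans ?_ (h.integral_ineq hm ht (hC m hm))
    rw [hK, ← intervalIntegral.integral_const_mul]
    apply intervalIntegral.integral_mono_on zero_le_one
    · exact (hck.const_mul _).intervalIntegrable _ _
    · exact ((h.sH2 hm).cont_u ht).intervalIntegrable _ _
    · intro u hu
      have h1 : X (t, u) * X (t, u) + Y (t, u) * Y (t, u) ≤ M := hM ⟨u, hu, rfl⟩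
      have hv := h.vpos (t, u) (mem_Om.2 ht)
      have hk : |k (t, u)| ≤ ff k m (t, u) := Real.abs_le_sqrt (by nlinarith)
      have h2 : Real.exp (-(m ^ 2 / 2) * M) ≤ ph X Y m (t, u) * ph X Y m (t, u) := by
        rw [ph, ← Real.exp_add]
        apply Real.exp_le_exp.2
        nlinarith [mul_le_mul_of_nonneg_left h1 (sq_nonneg m)]
      rw [H2, mul_comm (|k (t, u)|)]
      have := mul_self_nonneg (ph X Y m (t, u))
      gcongr
  have hlim : Tendsto (fun m : ℝ => Real.exp (-(m ^ 2 / 2) * M) * K) (nhdsWithin 0 (Ioi 0))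
      (nhds (Real.exp (-((0:ℝ) ^ 2 / 2) * M) * K)) := by
    have : Continuous fun m : ℝ => Real.exp (-(m ^ 2 / 2) * M) * K := by fun_prop
    exact (this.tendsto 0).mono_left nhdsWithin_le_nhds
  have := le_of_tendsto hlim (eventually_nhdsWithin_of_forall key)
  simpa using this

end Evolution

/-! ### From finite total curvature to finite entropy -/

/-- Primitive of the one-dimensional Gaussian. -/
def gp (l : ℝ) (x : ℝ) : ℝ := ∫ s in (0:ℝ)..x, Real.exp (-(1 / (4 * l)) * s ^ 2)

lemma gp_deriv (l x : ℝ) : HasDerivAt (gp l) (Real.exp (-(1 / (4 * l)) * x ^ 2)) x := by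
  have hc : Continuous fun s : ℝ => Real.exp (-(1 / (4 * l)) * s ^ 2) := by fun_prop
  exact intervalIntegral.integral_hasDerivAt_right (hc.intervalIntegrable _ _)
    (hc.stronglyMeasurableAtFilter _ _) hc.continuousAt

lemma gp_bound {l : ℝ} (hl : 0 < l) (x : ℝ) : |gp l x| ≤ √(4 * π * l) := by
  have hi : Integrable fun s : ℝ => Real.exp (-(1 / (4 * l)) * s ^ 2) :=
    integrable_exp_neg_mul_sq (by positivity)
  have h1 : ∫ s : ℝ, Real.exp (-(1 / (4 * l)) * s ^ 2) = √(4 * π * l) := by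
    rw [integral_gaussian]; congr 1; field_simp
  rw [← h1, gp, ← Real.norm_eq_abs]
  refine (intervalIntegral.norm_integral_le_integral_norm_uIoc).trans ?_
  simp only [Real.norm_eq_abs, Real.abs_exp]
  exact setIntegral_le_integral hi (Eventually.of_forall fun s => (Real.exp_pos _).le)

lemma cont_gauss {f g w : ℝ → ℝ} (hf : Continuous f) (hg : Continuous g) (hw : Continuous w)
    (x y l : ℝ) :
    Continuous fun u => Real.exp (-((f u - x) ^ 2 + (g u - y) ^ 2) / (4 * l)) * w u := by
  simp only [div_eq_mul_inv]; fun_prop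

lemma cont_G {f g w c d k : ℝ → ℝ} (hf : Continuous f) (hg : Continuous g) (hw : Continuous w)
    (hc : Continuous c) (hd : Continuous d) (hk : Continuous k) {q : ℝ → ℝ} (hq : Continuous q)
    (x y l : ℝ) : Continuous fun u =>
    (Real.exp (-(1 / (4 * l)) * (f u - x) ^ 2) * (w u * c u)) * c u
      + q (f u - x) * (- (w u * k u * d u))
    + ((Real.exp (-(1 / (4 * l)) * (g u - y) ^ 2) * (w u * d u)) * d u
      + q (g u - y) * (w u * k u * c u)) := by
  fun_prop

theorem CF.gauss_le {X Y v a b k : ℝ × ℝ → ℝ} (h : CF X Y v a b k) {l : ℝ} (hl : 0 < l)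
    (x y : ℝ) {t : ℝ} (ht : t ≤ 0) :
    ∫ u in (0:ℝ)..1, Real.exp (-((X (t, u) - x) ^ 2 + (Y (t, u) - y) ^ 2) / (4 * l)) * v (t, u)
      ≤ √(4 * π * l) * (2 * ∫ u in (0:ℝ)..1, |k (t, u)| * v (t, u)) := by
  have cX := h.sX.cont_u ht
  have cY := h.sY.cont_u ht
  have cv := h.sv.cont_u ht
  have ca := h.sa.cont_u ht
  have cb := h.sb.cont_u ht
  have ck := h.sk.cont_u ht
  have cg : Continuous (gp l) := continuous_iff_continuousAt.2 fun u => (gp_deriv l u).continuousAt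
  set S := √(4 * π * l) with hS
  set Ψ : ℝ → ℝ := fun u => gp l (X (t, u) - x) * a (t, u) + gp l (Y (t, u) - y) * b (t, u)
  set G : ℝ → ℝ := fun u =>
    (Real.exp (-(1 / (4 * l)) * (X (t, u) - x) ^ 2) * (v (t, u) * a (t, u))) * a (t, u)
      + gp l (X (t, u) - x) * (- (v (t, u) * k (t, u) * b (t, u)))
    + ((Real.exp (-(1 / (4 * l)) * (Y (t, u) - y) ^ 2) * (v (t, u) * b (t, u))) * b (t, u)
      + gp l (Y (t, u) - y) * (v (t, u) * k (t, u) * a (t, u)))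
  have hG : ∀ u, HasDerivAt Ψ (G u) u := by
    intro u
    have hp : (t, u) ∈ Om := mem_Om.2 ht
    have hX := h.sX.hasDerivAt_u ht u
    have hY := h.sY.hasDerivAt_u ht u
    have ha := h.sa.hasDerivAt_u ht u
    have hb := h.sb.hasDerivAt_u ht u
    rw [h.Xu _ hp] at hX
    rw [h.Yu _ hp] at hY
    rw [h.au _ hp] at ha
    rw [h.bu _ hp] at hb
    exact (((gp_deriv l _).comp u (hX.sub_const x)).mul ha).add
      (((gp_deriv l _).comp u (hY.sub_const y)).mul hb)
  have cG : Continuous G := cont_G cX cY cv ca cb ck cg x y l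
  have h0 : ∫ u in (0:ℝ)..1, G u = 0 := by
    rw [intervalIntegral.integral_eq_sub_of_hasDerivAt (fun u _ => hG u)
      (cG.intervalIntegrable _ _)]
    have e1 := h.pX t ht 0
    have e2 := h.pY t ht 0
    have e3 := h.pa t ht 0
    have e4 := h.pb t ht 0
    rw [zero_add] at e1 e2 e3 e4
    simp [Ψ, e1, e2, e3, e4]
  have cK : Continuous fun u => |k (t, u)| * v (t, u) := ck.abs.mul cv
  have hle : ∫ u in (0:ℝ)..1,
      Real.exp (-((X (t, u) - x) ^ 2 + (Y (t, u) - y) ^ 2) / (4 * l)) * v (t, u)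
      ≤ ∫ u in (0:ℝ)..1, (G u + S * (2 * (|k (t, u)| * v (t, u)))) := by
    apply intervalIntegral.integral_mono_on zero_le_one
    · exact (cont_gauss cX cY cv x y l).intervalIntegrable _ _
    · apply Continuous.intervalIntegrable; fun_prop
    · intro u _
      have hp : (t, u) ∈ Om := mem_Om.2 ht
      have hab := h.ab _ hp
      have hv := h.vpos _ hp
      have b1 := gp_bound hl (X (t, u) - x)
      have b2 := gp_bound hl (Y (t, u) - y)
      rw [← hS] at b1 b2
      have hl' : 0 < 1 / (4 * l) := by positivity
      have e1 : Real.exp (-((X (t, u) - x) ^ 2 + (Y (t, u) - y) ^ 2) / (4 * l))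
          ≤ Real.exp (-(1 / (4 * l)) * (X (t, u) - x) ^ 2) := by
        apply Real.exp_le_exp.2
        have : 0 ≤ 1 / (4 * l) * (Y (t, u) - y) ^ 2 := by positivity
        calc _ = -(1 / (4 * l)) * (X (t, u) - x) ^ 2 - 1 / (4 * l) * (Y (t, u) - y) ^ 2 := by ring
          _ ≤ _ := by linarith
      have e2 : Real.exp (-((X (t, u) - x) ^ 2 + (Y (t, u) - y) ^ 2) / (4 * l))
          ≤ Real.exp (-(1 / (4 * l)) * (Y (t, u) - y) ^ 2) := by
        apply Real.exp_le_exp.2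
        have : 0 ≤ 1 / (4 * l) * (X (t, u) - x) ^ 2 := by positivity
        calc _ = -(1 / (4 * l)) * (Y (t, u) - y) ^ 2 - 1 / (4 * l) * (X (t, u) - x) ^ 2 := by ring
          _ ≤ _ := by linarith
      simp only [G]
      set E := Real.exp (-((X (t, u) - x) ^ 2 + (Y (t, u) - y) ^ 2) / (4 * l))
      set E1 := Real.exp (-(1 / (4 * l)) * (X (t, u) - x) ^ 2)
      set E2 := Real.exp (-(1 / (4 * l)) * (Y (t, u) - y) ^ 2)
      set g1 := gp l (X (t, u) - x)
      set g2 := gp l (Y (t, u) - y)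
      set A := a (t, u)
      set B := b (t, u)
      set V := v (t, u)
      set κ := k (t, u)
      have hA : |A| ≤ 1 := abs_le_one_iff_mul_self_le_one.2 (by nlinarith [mul_self_nonneg B])
      have hB : |B| ≤ 1 := abs_le_one_iff_mul_self_le_one.2 (by nlinarith [mul_self_nonneg A])
      have f1 : E * (V * (A * A)) ≤ E1 * (V * (A * A)) := by
        have := mul_self_nonneg A
        gcongr
      have f2 : E * (V * (B * B)) ≤ E2 * (V * (B * B)) := by
        have := mul_self_nonneg B
        gcongr
      have hS0 : 0 ≤ S := Real.sqrt_nonneg _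
      have f3 : |g1 * (V * κ * B)| ≤ S * (|κ| * V) := by
        rw [abs_mul, abs_mul, abs_mul, abs_of_pos hv]
        calc |g1| * (V * |κ| * |B|) ≤ S * (V * |κ| * 1) := by gcongr
          _ = _ := by ring
      have f4 : |g2 * (V * κ * A)| ≤ S * (|κ| * V) := by
        rw [abs_mul, abs_mul, abs_mul, abs_of_pos hv]
        calc |g2| * (V * |κ| * |A|) ≤ S * (V * |κ| * 1) := by gcongr
          _ = _ := by ring
      have f5 : E * V = E * (V * (A * A)) + E * (V * (B * B)) := by
        linear_combination (- E * V) * hab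
      have f6 := le_abs_self (g1 * (V * κ * B))
      have f7 := neg_abs_le (g2 * (V * κ * A))
      rw [f5]
      linarith
  refine hle.trans (le_of_eq ?_)
  rw [intervalIntegral.integral_add (cG.intervalIntegrable _ _)
    (Continuous.intervalIntegrable (by fun_prop) _ _), h0, zero_add,
    intervalIntegral.integral_const_mul, intervalIntegral.integral_const_mul]

/-! ### Conclusion -/

lemma lintegral_Ico_eq {g : ℝ → ℝ} (hg : Continuous g) (h0 : ∀ u, 0 ≤ g u) :
    ∫⁻ u in Ico (0:ℝ) 1, ENNReal.ofReal (g u) = ENNReal.ofReal (∫ u in (0:ℝ)..1, g u) := by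
  rw [intervalIntegral.integral_of_le zero_le_one, ← integral_Ico_eq_integral_Ioc,
    ofReal_integral_eq_lintegral_ofReal]
  · exact (hg.integrableOn_Icc (a := 0) (b := 1)).mono_set Ico_subset_Icc_self
  · exact Eventually.of_forall h0

/-- An ancient closed embedded smooth curve shortening flow has finite
total curvature if and only if it has finite entropy. -/
theorem finite_total_curvature_iff_finite_entropy_closed
    (γ : ℝ → ℝ → R2)
    (hcsf : IsCSF γ (Iic 0))
    (hper : ∀ (u t : ℝ), γ (u + 1) t = γ u t)
    (hemb : ∀ t ∈ Iic (0:ℝ), InjOn (fun u => γ u t) (Ico 0 1)) :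
    (⨆ t ∈ Iic (0:ℝ), totalCurvClosedE γ t) < ⊤ ↔ entropyClosedE γ (Iic 0) < ⊤ := by
  obtain ⟨X, Y, v, a, b, k, h, hγ, hv, hk⟩ := exists_CF γ hcsf hper
  have hcurv : ∀ t ≤ 0, totalCurvClosedE γ t
      = ENNReal.ofReal (∫ u in (0:ℝ)..1, |k (t, u)| * v (t, u)) := by
    intro t ht
    rw [← lintegral_Ico_eq (g := fun u => |k (t, u)| * v (t, u)) ((h.sk.cont_u ht).abs.mul (h.sv.cont_u ht))
      (fun u => mul_nonneg (abs_nonneg _) (h.vpos _ (mem_Om.2 ht)).le), totalCurvClosedE]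
    simp only [hv t ht, hk t ht]
  have hnorm : ∀ (x₀ : R2) (t u : ℝ), ‖γ u t - x₀‖ ^ 2
      = (X (t, u) - x₀ 0) ^ 2 + (Y (t, u) - x₀ 1) ^ 2 := by
    intro x₀ t u
    rw [hγ t u, EuclideanSpace.norm_sq_eq]
    simp [toR2, Fin.sum_univ_two]
  have hgauss : ∀ (x₀ : R2) (l : ℝ), ∀ t ≤ 0, gaussLenClosedE γ x₀ l t
      = (ENNReal.ofReal (√(4 * π * l)))⁻¹ * ENNReal.ofReal (∫ u in (0:ℝ)..1,
        Real.exp (-((X (t, u) - x₀ 0) ^ 2 + (Y (t, u) - x₀ 1) ^ 2) / (4 * l)) * v (t, u)) := by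
    intro x₀ l t ht
    have cX := h.sX.cont_u ht
    have cY := h.sY.cont_u ht
    have cv := h.sv.cont_u ht
    rw [← lintegral_Ico_eq (cont_gauss cX cY cv (x₀ 0) (x₀ 1) l)
      (fun u => mul_nonneg (Real.exp_pos _).le (h.vpos _ (mem_Om.2 ht)).le), gaussLenClosedE]
    simp only [hv t ht, hnorm]
  constructor
  · intro hfin
    set K := ⨆ t ∈ Iic (0:ℝ), totalCurvClosedE γ t with hK
    refine lt_of_le_of_lt (b := 2 * K) ?_ (ENNReal.mul_lt_top (by simp) hfin)
    refine iSup₂_le fun t ht => iSup_le fun x₀ => iSup₂_le fun l hl => ?_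
    have hl0 : 0 < l := hl
    have hS : 0 < √(4 * π * l) := Real.sqrt_pos.2 (by positivity)
    have hle : totalCurvClosedE γ t ≤ K := le_iSup₂ (f := fun t (_ : t ∈ Iic (0:ℝ)) =>
      totalCurvClosedE γ t) t ht
    have h1 := h.gauss_le hl0 (x₀ 0) (x₀ 1) ht
    rw [hgauss x₀ l t ht]
    calc _ ≤ (ENNReal.ofReal (√(4 * π * l)))⁻¹ * ENNReal.ofReal (√(4 * π * l) *
            (2 * ∫ u in (0:ℝ)..1, |k (t, u)| * v (t, u))) := by
          gcongr
      _ = 2 * totalCurvClosedE γ t := by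
          rw [ENNReal.ofReal_mul hS.le, ← mul_assoc, ENNReal.inv_mul_cancel, one_mul,
            ENNReal.ofReal_mul (by norm_num), hcurv t ht]
          · simp
          · simpa using hS
          · simp
      _ ≤ 2 * K := by gcongr
  · intro hfin
    set E := entropyClosedE γ (Iic 0) with hE
    set C : ℝ := √(4 * π) * E.toReal with hC
    have hbound : ∀ m > 0, ∀ t ≤ 0, m * ∫ u in (0:ℝ)..1, H1 X Y v m (t, u) ≤ C := by
      intro m hm t ht
      have hl : 0 < (m ^ 2)⁻¹ := by positivity
      have h1 : gaussLenClosedE γ 0 (m ^ 2)⁻¹ t ≤ E := by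
        rw [hE, entropyClosedE]
        refine le_trans ?_ (le_iSup₂ (f := fun t (_ : t ∈ Iic (0:ℝ)) =>
          ⨆ x₀ : R2, ⨆ l ∈ Ioi (0:ℝ), gaussLenClosedE γ x₀ l t) t ht)
        refine le_trans ?_ (le_iSup (fun x₀ : R2 =>
          ⨆ l ∈ Ioi (0:ℝ), gaussLenClosedE γ x₀ l t) 0)
        exact le_iSup₂ (f := fun l (_ : l ∈ Ioi (0:ℝ)) => gaussLenClosedE γ 0 l t) _ hl
      rw [hgauss 0 _ t ht] at h1
      have h2 : ∫ u in (0:ℝ)..1, Real.exp (-((X (t, u) - (0 : R2) 0) ^ 2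
          + (Y (t, u) - (0 : R2) 1) ^ 2) / (4 * (m ^ 2)⁻¹)) * v (t, u)
          = ∫ u in (0:ℝ)..1, H1 X Y v m (t, u) := by
        apply intervalIntegral.integral_congr
        intro u _
        simp only [H1, ph]
        congr 2
        simp
        field_simp
        ring
      rw [h2] at h1
      have hS : √(4 * π * (m ^ 2)⁻¹) = √(4 * π) / m := by
        rw [← div_eq_mul_inv, Real.sqrt_div' _ (sq_nonneg m), Real.sqrt_sq hm.le]
      have hS4 : 0 < √(4 * π) := Real.sqrt_pos.2 (by positivity)
      have hI : 0 ≤ ∫ u in (0:ℝ)..1, H1 X Y v m (t, u) :=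
        intervalIntegral.integral_nonneg zero_le_one fun u _ =>
          mul_nonneg (ph_pos _ _).le (h.vpos _ (mem_Om.2 ht)).le
      have h3 := ENNReal.toReal_mono hfin.ne h1
      rw [ENNReal.toReal_mul, ENNReal.toReal_inv, ENNReal.toReal_ofReal (Real.sqrt_nonneg _),
        ENNReal.toReal_ofReal hI, hS] at h3
      rw [hC]
      calc _ = √(4 * π) * ((√(4 * π) / m)⁻¹ * ∫ u in (0:ℝ)..1, H1 X Y v m (t, u)) := by
            field_simp
        _ ≤ _ := by gcongr
    refine lt_of_le_of_lt (b := ENNReal.ofReal (35 / 2 * C)) ?_ ENNReal.ofReal_lt_top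
    refine iSup₂_le fun t ht => ?_
    rw [hcurv t ht]
    exact ENNReal.ofReal_le_ofReal (h.totalCurv_le hbound ht)
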